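/- arXiv:2508.15686 — 2 statements merged into one kernel-verified Lean document; each statement's English description precedes it below -/
import Mathlib

section
/- Every infinite-dimensional Banach space over ℝ or ℂ has a Hamel (algebraic) basis whose cardinality equals the cardinality of the space itself. -/
open Cardinal in
/-- An `RCLike` field has at most the cardinality of the continuum. -/
theorem RCLike.mk_le_continuum (𝕜 : Type*) [RCLike 𝕜] : #𝕜 ≤ 𝔠 := by
  have hinj : Function.Injective fun z : 𝕜 ↦ (RCLike.re z, RCLike.im z) := fun z w hzw ↦
    RCLike.ext (congrArg Prod.fst hzw) (congrArg Prod.snd hzw)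
  have := Cardinal.lift_mk_le_lift_mk_of_injective hinj
  simpa [Cardinal.mk_prod, Cardinal.mk_real, Cardinal.continuum_mul_self] using this

/-- In an infinite-dimensional space, finitely many linear functionals have a common nonzero
zero. -/
theorem exists_ne_zero_forall_apply_eq_zero {𝕜 E : Type*} [Field 𝕜] [AddCommGroup E] [Module 𝕜 E]
    (h : ¬ FiniteDimensional 𝕜 E) {ι : Type*} [Finite ι] (f : ι → E →ₗ[𝕜] 𝕜) :
    ∃ x : E, x ≠ 0 ∧ ∀ i, f i x = 0 := by
  by_contra! hc
  refine h (Module.Finite.of_injective (LinearMap.pi f) ?_)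
  rw [injective_iff_map_eq_zero]
  intro x hx
  by_contra hx0
  obtain ⟨i, hi⟩ := hc x hx0
  exact hi (congrFun hx i)

/-- An infinite-dimensional normed space has a sequence of unit vectors with a triangular system of
continuous functionals. -/
theorem exists_seq_norm_eq_one_triangular {𝕜 E : Type*} [RCLike 𝕜] [NormedAddCommGroup E]
    [NormedSpace 𝕜 E] (h : ¬ FiniteDimensional 𝕜 E) :
    ∃ (x : ℕ → E) (f : ℕ → E →L[𝕜] 𝕜), (∀ n, ‖x n‖ = 1) ∧ (∀ n, f n (x n) ≠ 0) ∧
      ∀ m n, m < n → f m (x n) = 0 := by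
  obtain ⟨u, hu, hlt⟩ := exists_seq_of_forall_finset_exists
    (fun p : E × (E →L[𝕜] 𝕜) ↦ ‖p.1‖ = 1 ∧ p.2 p.1 ≠ 0) (fun p q ↦ p.2 q.1 = 0) <| by
      intro s _
      obtain ⟨x, hx, hs⟩ := exists_ne_zero_forall_apply_eq_zero h
        fun p : s ↦ (p.1.2 : E →ₗ[𝕜] 𝕜)
      have hn : ‖((‖x‖⁻¹ : ℝ) : 𝕜) • x‖ = 1 := by
        simp [norm_smul, hx]
      obtain ⟨g, -, hg⟩ := exists_dual_vector 𝕜 (((‖x‖⁻¹ : ℝ) : 𝕜) • x)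
        (norm_ne_zero_iff.1 (by rw [hn]; norm_num))
      refine ⟨(((‖x‖⁻¹ : ℝ) : 𝕜) • x, g), ⟨hn, ?_⟩, fun p hp ↦ ?_⟩
      · rw [hg, hn]; simp
      · have : p.2 x = 0 := hs ⟨p, hp⟩
        simp [this]
  exact ⟨fun n ↦ (u n).1, fun n ↦ (u n).2, fun n ↦ (hu n).1, fun n ↦ (hu n).2, hlt⟩

/-- If a sequence admits a triangular system of continuous functionals, then the coefficients of
any series in it which converges to zero vanish. -/
theorem HasSum.eq_zero_of_triangular {𝕜 E : Type*} [RCLike 𝕜] [NormedAddCommGroup E]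
    [NormedSpace 𝕜 E] {x : ℕ → E} {f : ℕ → E →L[𝕜] 𝕜} (hne : ∀ n, f n (x n) ≠ 0)
    (hlt : ∀ m n, m < n → f m (x n) = 0) {b : ℕ → 𝕜} (hb : HasSum (fun n ↦ b n • x n) 0) (n : ℕ) :
    b n = 0 := by
  induction n using Nat.strong_induction_on with
  | _ n ih =>
    have h1 : HasSum (fun k ↦ f n (b k • x k)) 0 := by simpa using (f n).hasSum hb
    have h2 : HasSum (fun k ↦ f n (b k • x k)) (f n (b n • x n)) := by
      refine hasSum_single n fun k hk ↦ ?_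
      rcases lt_or_gt_of_ne hk with hk | hk
      · simp [ih k hk]
      · simp [hlt n k hk]
    simpa [hne n] using h2.unique h1

/-- Geometric sequences with distinct ratios are linearly independent. -/
theorem linearIndependent_pow_sequence (R : Type*) [CommRing R] [IsDomain R] :
    LinearIndependent R (fun (t : R) (n : ℕ) ↦ t ^ n) := by
  have := (linearIndependent_monoidHom (Multiplicative ℕ) R).comp (powersHom R)
    (powersHom R).injective
  exact this

open Cardinal in
/-- The dimension of an infinite-dimensional Banach space is at least the continuum. -/
theorem continuum_le_rank_of_not_finiteDimensional {𝕜 E : Type*} [RCLike 𝕜] [NormedAddCommGroup E]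
    [NormedSpace 𝕜 E] [CompleteSpace E] (h : ¬ FiniteDimensional 𝕜 E) :
    𝔠 ≤ Module.rank 𝕜 E := by
  obtain ⟨x, f, hx, hne, hlt⟩ := exists_seq_norm_eq_one_triangular h
  have hsum (t : Set.Ioo (0 : ℝ) 1) : Summable fun n ↦ ((t : ℝ) : 𝕜) ^ n • x n := by
    refine .of_norm ?_
    simpa [norm_smul, hx, abs_of_pos t.2.1] using summable_geometric_of_lt_one t.2.1.le t.2.2
  have hli : LinearIndependent 𝕜
      fun t : Set.Ioo (0 : ℝ) 1 ↦ ∑' n, ((t : ℝ) : 𝕜) ^ n • x n := by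
    have hpow := (linearIndependent_pow_sequence 𝕜).comp
      (fun t : Set.Ioo (0 : ℝ) 1 ↦ ((t : ℝ) : 𝕜))
      (RCLike.ofReal_injective.comp Subtype.val_injective)
    rw [linearIndependent_iff'] at hpow ⊢
    intro s g hg
    refine hpow s g (funext fun n ↦ ?_)
    have hs := hasSum_sum fun t (_ : t ∈ s) ↦ (hsum t).hasSum.const_smul (g t)
    rw [hg] at hs
    simp only [smul_smul, ← Finset.sum_smul] at hs
    simpa using hs.eq_zero_of_triangular hne hlt n
  simpa [Cardinal.mk_Ioo_real] using hli.cardinal_lift_le_rank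

open Cardinal in
/-- An infinite basis of a vector space which is at least as large as the scalar field has the
cardinality of the space. -/
theorem Module.Basis.mk_eq_of_lift_mk_le.{u, v} {K : Type u} {V : Type v} [Field K]
    [AddCommGroup V] [Module K V] {ι : Type v} [Infinite ι] (b : Module.Basis ι K V)
    (h : lift.{v} #K ≤ lift.{u} #ι) : #ι = #V := by
  have hV := mk_congr_lift b.repr.toEquiv
  rw [mk_finsupp_lift_of_infinite, max_eq_left h, lift_umax.{v, u}, lift_id'.{v, max u v}] at hV
  exact (lift_injective hV).symm

/-- every infinite-dimensional Banach space has a Hamel basis whose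
cardinality equals the cardinality of the space. -/
theorem stmt11 {𝕜 E : Type*} [RCLike 𝕜] [NormedAddCommGroup E] [NormedSpace 𝕜 E]
    [CompleteSpace E] (h : ¬ FiniteDimensional 𝕜 E) :
    ∃ s : Set E, LinearIndependent 𝕜 ((↑) : s → E) ∧ Submodule.span 𝕜 s = ⊤ ∧
      Cardinal.mk s = Cardinal.mk E := by
  let b := Module.Basis.ofVectorSpace 𝕜 E
  have hc : Cardinal.continuum ≤ Cardinal.mk (Module.Basis.ofVectorSpaceIndex 𝕜 E) :=
    (continuum_le_rank_of_not_finiteDimensional h).trans_eq b.mk_eq_rank''.symm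
  have : Infinite (Module.Basis.ofVectorSpaceIndex 𝕜 E) :=
    Cardinal.infinite_iff.2 (Cardinal.aleph0_le_continuum.trans hc)
  exact ⟨Module.Basis.ofVectorSpaceIndex 𝕜 E, Module.Basis.ofVectorSpaceIndex.linearIndependent 𝕜 E,
    by simpa [b] using b.span_eq, b.mk_eq_of_lift_mk_le <|
      (Cardinal.lift_le_continuum.2 (RCLike.mk_le_continuum 𝕜)).trans
        (Cardinal.continuum_le_lift.2 hc)⟩
end

section
/- For every infinite-dimensional separable Banach space (E, ‖·‖₁) there exists a norm ‖·‖₂ such that (E, ‖·‖₂) is a non-separable Banach space and ‖·‖₁ and ‖·‖₂ are not equivalent. -/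
/-- `n` satisfies the axioms of a norm on the `𝕜`-vector space `E`. -/
def IsNormOn (𝕜 : Type*) {E : Type*} [RCLike 𝕜] [AddCommGroup E] [Module 𝕜 E]
    (n : E → ℝ) : Prop :=
  (∀ u : E, n u = 0 ↔ u = 0) ∧
  (∀ (a : 𝕜) (u : E), n (a • u) = ‖a‖ * n u) ∧
  (∀ u v : E, n (u + v) ≤ n u + n v)

/-- `u` is a Cauchy sequence with respect to the norm function `n`. -/
def IsCauchyWith {E : Type*} [AddCommGroup E] (n : E → ℝ) (u : ℕ → E) : Prop :=
  ∀ ε > (0 : ℝ), ∃ N : ℕ, ∀ m ≥ N, ∀ k ≥ N, n (u m - u k) < ε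

/-- `E` is complete with respect to the norm function `n`. -/
def CompleteWith {E : Type*} [AddCommGroup E] (n : E → ℝ) : Prop :=
  ∀ u : ℕ → E, IsCauchyWith n u →
    ∃ l : E, ∀ ε > (0 : ℝ), ∃ N : ℕ, ∀ m ≥ N, n (u m - l) < ε

/-- `E` is separable with respect to the norm function `n`: some countable set is
dense for `n`. -/
def SeparableWith {E : Type*} [AddCommGroup E] (n : E → ℝ) : Prop :=
  ∃ D : Set E, D.Countable ∧ ∀ u : E, ∀ ε > (0 : ℝ), ∃ d ∈ D, n (u - d) < ε

open Cardinal TopologicalSpace BoundedContinuousFunction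

theorem mk_le_continuum_of_secondCountable (X : Type*) [TopologicalSpace X] [T0Space X]
    [SecondCountableTopology X] : #X ≤ 𝔠 := by
  have hinj : Function.Injective fun x : X ↦ {s : countableBasis X | x ∈ s.1} := by
    intro x y hxy
    refine (isBasis_countableBasis X).eq_iff.2 fun s hs ↦ ?_
    exact Set.ext_iff.1 hxy ⟨s, hs⟩
  calc #X ≤ #(Set (countableBasis X)) := mk_le_of_injective hinj
    _ = 2 ^ #(countableBasis X) := mk_set
    _ ≤ 2 ^ ℵ₀ :=
      power_le_power_left two_ne_zero (countable_countableBasis X).le_aleph0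
    _ = 𝔠 := two_power_aleph0

section Rank

variable (𝕜 : Type*) [RCLike 𝕜]

theorem rank_boundedContinuousFunction_nat_le_continuum :
    Module.rank 𝕜 (ℕ →ᵇ 𝕜) ≤ 𝔠 := by
  calc Module.rank 𝕜 (ℕ →ᵇ 𝕜) ≤ #(ℕ →ᵇ 𝕜) := rank_le_card _ _
    _ ≤ #(ℕ → 𝕜) := mk_le_of_injective DFunLike.coe_injective
    _ ≤ 𝔠 := mk_le_continuum_of_secondCountable _

/-- The geometric sequences of ratio in `(0, 1)` are linearly independent. -/
theorem continuum_le_rank_boundedContinuousFunction_nat :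
    𝔠 ≤ Module.rank 𝕜 (ℕ →ᵇ 𝕜) := by
  let v : Set.Ioo (0 : ℝ) 1 → (ℕ →ᵇ 𝕜) := fun t ↦
    ofNormedAddCommGroupDiscrete (fun n ↦ (t.1 : 𝕜) ^ n) 1 fun n ↦ by
      rw [norm_pow, RCLike.norm_ofReal, abs_of_pos t.2.1]
      exact pow_le_one₀ t.2.1.le t.2.2.le
  let Φ : (ℕ →ᵇ 𝕜) →ₗ[𝕜] (Multiplicative ℕ → 𝕜) :=
    { toFun := fun a n ↦ a n.toAdd
      map_add' := fun _ _ ↦ rfl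
      map_smul' := fun _ _ ↦ rfl }
  let g : Set.Ioo (0 : ℝ) 1 → (Multiplicative ℕ →* 𝕜) := fun t ↦ powersHom 𝕜 (t.1 : 𝕜)
  have hg : Function.Injective g := fun s t hst ↦
    Subtype.ext (RCLike.ofReal_injective ((powersHom 𝕜).injective hst))
  have hv : LinearIndependent 𝕜 v :=
    LinearIndependent.of_comp Φ ((linearIndependent_monoidHom (Multiplicative ℕ) 𝕜).comp g hg)
  simpa [mk_Ioo_real zero_lt_one] using hv.cardinal_lift_le_rank

theorem rank_boundedContinuousFunction_nat : Module.rank 𝕜 (ℕ →ᵇ 𝕜) = 𝔠 :=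
  (rank_boundedContinuousFunction_nat_le_continuum 𝕜).antisymm
    (continuum_le_rank_boundedContinuousFunction_nat 𝕜)

variable {𝕜} {E : Type*} [NormedAddCommGroup E] [NormedSpace 𝕜 E]

theorem exists_ne_zero_forall_dual_eq_zero (h : ¬ FiniteDimensional 𝕜 E)
    (s : Finset (StrongDual 𝕜 E)) : ∃ x : E, x ≠ 0 ∧ ∀ f ∈ s, f x = 0 := by
  by_contra! hs
  let Φ : E →ₗ[𝕜] (s → 𝕜) := LinearMap.pi fun f ↦ (f.1 : E →ₗ[𝕜] 𝕜)
  refine h (Module.Finite.of_injective Φ ((injective_iff_map_eq_zero Φ).2 fun x hx ↦ ?_))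
  by_contra hx0
  obtain ⟨f, hf, hfx⟩ := hs x hx0
  exact hfx (congrFun hx ⟨f, hf⟩)

theorem exists_triangular_seq (h : ¬ FiniteDimensional 𝕜 E) :
    ∃ (x : ℕ → E) (f : ℕ → StrongDual 𝕜 E), (∀ n, ‖x n‖ = 1) ∧ (∀ n, f n (x n) = 1) ∧
      ∀ m n, m < n → f m (x n) = 0 := by
  classical
  obtain ⟨p, hp, hr⟩ := exists_seq_of_forall_finset_exists
    (fun p : E × StrongDual 𝕜 E ↦ ‖p.1‖ = 1 ∧ p.2 p.1 = 1) (fun p q ↦ p.2 q.1 = 0)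
    fun s _ ↦ by
      obtain ⟨x, hx0, hx⟩ := exists_ne_zero_forall_dual_eq_zero h (s.image Prod.snd)
      have hy : ‖((‖x‖⁻¹ : ℝ) : 𝕜) • x‖ = 1 := by
        rw [norm_smul, RCLike.norm_ofReal, abs_of_nonneg (by positivity),
          inv_mul_cancel₀ (norm_ne_zero_iff.2 hx0)]
      obtain ⟨g, -, hg⟩ := exists_dual_vector 𝕜 _ (hy.trans_ne one_ne_zero)
      refine ⟨(_, g), ⟨hy, by rw [hg, hy, RCLike.ofReal_one]⟩, fun q hq ↦ ?_⟩
      rw [map_smul, hx q.2 (Finset.mem_image_of_mem _ hq), smul_zero]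
  exact ⟨fun n ↦ (p n).1, fun n ↦ (p n).2, fun n ↦ (hp n).1, fun n ↦ (hp n).2, hr⟩

theorem exists_injective_boundedContinuousFunction_nat [CompleteSpace E]
    (h : ¬ FiniteDimensional 𝕜 E) :
    ∃ T : (ℕ →ᵇ 𝕜) →ₗ[𝕜] E, Function.Injective T := by
  obtain ⟨x, f, hx, hfx, hf⟩ := exists_triangular_seq h
  have hsum (a : ℕ →ᵇ 𝕜) : Summable fun n ↦ (a n * (1 / 2) ^ n) • x n := by
    refine .of_norm_bounded (summable_geometric_two.mul_left ‖a‖) fun n ↦ ?_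
    rw [norm_smul, hx, mul_one, norm_mul, norm_pow, norm_div, norm_one, RCLike.norm_ofNat]
    gcongr
    exact a.norm_coe_le_norm n
  let T : (ℕ →ᵇ 𝕜) →ₗ[𝕜] E :=
    { toFun := fun a ↦ ∑' n, (a n * (1 / 2) ^ n) • x n
      map_add' := fun a b ↦ by
        rw [← (hsum a).tsum_add (hsum b)]
        simp only [BoundedContinuousFunction.add_apply, add_mul, add_smul]
      map_smul' := fun c a ↦ by
        rw [RingHom.id_apply, ← (hsum a).tsum_const_smul c]
        simp only [BoundedContinuousFunction.smul_apply, smul_eq_mul, mul_assoc, mul_smul] }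
  refine ⟨T, (injective_iff_map_eq_zero T).2 fun a ha ↦ ?_⟩
  ext n
  induction n using Nat.strong_induction_on with
  | _ n ih =>
    have hn : f n (T a) = a n * (1 / 2) ^ n := by
      change f n (∑' k, (a k * (1 / 2) ^ k) • x k) = _
      rw [(f n).map_tsum (hsum a), tsum_eq_single n, map_smul, hfx, smul_eq_mul, mul_one]
      intro k hk
      rcases hk.lt_or_gt with hk | hk
      · simp [ih k hk]
      · simp [hf n k hk]
    rw [ha, map_zero] at hn
    exact (mul_eq_zero.1 hn.symm).resolve_right (pow_ne_zero n (one_div_ne_zero two_ne_zero))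

theorem continuum_le_rank [CompleteSpace E] (h : ¬ FiniteDimensional 𝕜 E) :
    𝔠 ≤ Module.rank 𝕜 E := by
  obtain ⟨T, hT⟩ := exists_injective_boundedContinuousFunction_nat h
  simpa [rank_boundedContinuousFunction_nat] using T.lift_rank_le_of_injective hT

theorem nonempty_linearEquiv_boundedContinuousFunction_nat [CompleteSpace E] [SeparableSpace E]
    (h : ¬ FiniteDimensional 𝕜 E) : Nonempty (E ≃ₗ[𝕜] (ℕ →ᵇ 𝕜)) := by
  have : SecondCountableTopology E := UniformSpace.secondCountable_of_separable E
  have hE : Module.rank 𝕜 E = 𝔠 :=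
    ((rank_le_card _ _).trans (mk_le_continuum_of_secondCountable E)).antisymm (continuum_le_rank h)
  apply nonempty_linearEquiv_of_lift_rank_eq
  rw [hE, rank_boundedContinuousFunction_nat, lift_continuum, lift_continuum]

/-- Cantor's diagonal argument: no sequence is dense among the bounded sequences. -/
theorem exists_forall_one_le_norm_sub (d : ℕ → (ℕ →ᵇ 𝕜)) :
    ∃ b : ℕ →ᵇ 𝕜, ∀ n, 1 ≤ ‖b - d n‖ := by
  refine ⟨ofNormedAddCommGroupDiscrete (fun n ↦ if 1 ≤ ‖d n n‖ then 0 else 2) 2 fun n ↦ ?_,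
    fun n ↦ le_trans ?_ (norm_coe_le_norm _ n)⟩
  · split_ifs <;> simp
  · rw [BoundedContinuousFunction.sub_apply, coe_ofNormedAddCommGroupDiscrete]
    split_ifs with hn
    · simpa using hn
    · have := norm_sub_norm_le (2 : 𝕜) (d n n)
      rw [RCLike.norm_ofNat] at this
      linarith

end Rank

section LinearEquiv

variable {𝕜 E F : Type*} [RCLike 𝕜] [AddCommGroup E] [Module 𝕜 E]
  [NormedAddCommGroup F] [NormedSpace 𝕜 F]

theorem isNormOn_norm_comp (e : E ≃ₗ[𝕜] F) : IsNormOn 𝕜 fun u ↦ ‖e u‖ := by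
  refine ⟨fun u ↦ by simp, fun a u ↦ by simp [norm_smul], fun u v ↦ ?_⟩
  simpa only [map_add] using norm_add_le (e u) (e v)

theorem completeWith_norm_comp [CompleteSpace F] (e : E ≃ₗ[𝕜] F) :
    CompleteWith fun u ↦ ‖e u‖ := by
  intro u hu
  have hc : CauchySeq fun n ↦ e (u n) := Metric.cauchySeq_iff.2 fun ε hε ↦ by
    simpa only [dist_eq_norm, map_sub] using hu ε hε
  obtain ⟨l, hl⟩ := cauchySeq_tendsto_of_complete hc
  refine ⟨e.symm l, fun ε hε ↦ ?_⟩
  simpa [dist_eq_norm] using Metric.tendsto_atTop.1 hl ε hε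

theorem not_separableWith_norm_comp (e : E ≃ₗ[𝕜] (ℕ →ᵇ 𝕜)) :
    ¬ SeparableWith fun u ↦ ‖e u‖ := by
  rintro ⟨D, hD, hdense⟩
  obtain ⟨x, hx, -⟩ := hdense 0 1 one_pos
  obtain ⟨d, rfl⟩ := hD.exists_eq_range ⟨x, hx⟩
  obtain ⟨b, hb⟩ := exists_forall_one_le_norm_sub fun n ↦ e (d n)
  obtain ⟨_, ⟨n, rfl⟩, hn⟩ := hdense (e.symm b) 1 one_pos
  simp only [map_sub, e.apply_symm_apply] at hn
  exact (hb n).not_gt hn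

end LinearEquiv

theorem separableWith_of_le_mul_norm {E : Type*} [NormedAddCommGroup E] [SeparableSpace E]
    {n : E → ℝ} {c : ℝ} (hc : 0 < c) (hn : ∀ u, n u ≤ c * ‖u‖) : SeparableWith n := by
  obtain ⟨D, hD, hdense⟩ := exists_countable_dense E
  refine ⟨D, hD, fun u ε hε ↦ ?_⟩
  obtain ⟨d, hd, hud⟩ := Metric.dense_iff.1 hdense u (ε / c) (by positivity)
  refine ⟨d, hud, (hn _).trans_lt ?_⟩
  rwa [Metric.mem_ball', dist_eq_norm, lt_div_iff₀' hc] at hd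

/-- every infinite-dimensional separable Banach space admits a second
complete norm which is non-separable and not equivalent to the original norm. -/
theorem stmt12 {𝕜 E : Type*} [RCLike 𝕜] [NormedAddCommGroup E] [NormedSpace 𝕜 E]
    [CompleteSpace E] [TopologicalSpace.SeparableSpace E]
    (h : ¬ FiniteDimensional 𝕜 E) :
    ∃ n₂ : E → ℝ, IsNormOn 𝕜 n₂ ∧ CompleteWith n₂ ∧ ¬ SeparableWith n₂ ∧
      ¬ ∃ c₁ > (0 : ℝ), ∃ c₂ > (0 : ℝ), ∀ u : E, c₁ * ‖u‖ ≤ n₂ u ∧ n₂ u ≤ c₂ * ‖u‖ := by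
  obtain ⟨e⟩ := nonempty_linearEquiv_boundedContinuousFunction_nat h
  refine ⟨fun u ↦ ‖e u‖, isNormOn_norm_comp e, completeWith_norm_comp e,
    not_separableWith_norm_comp e, ?_⟩
  rintro ⟨c₁, -, c₂, hc₂, hle⟩
  exact not_separableWith_norm_comp e (separableWith_of_le_mul_norm hc₂ fun u ↦ (hle u).2)
end
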